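/- arXiv:1503.01641 — 3 statements merged into one kernel-verified Lean document; each statement's English description precedes it below -/
import Mathlib

section
/- The piecewise-defined starter S̃(g,L), given by: S̃ = L + 2.30g if 4 − 1.9g < L; S̃ = L + 1.90g if 2.74 − 1.56g < L ≤ 4 − 1.9g; S̃ = L + 1.56g if 2.01 − 1.33g < L ≤ 2.74 − 1.56g; S̃ = L + 1.33g if 1.60 − 1.16g < L ≤ 2.01 − 1.33g; S̃ = L + 1.16g if 1.32 − 1.02g < L ≤ 1.60 − 1.16g; S̃ = L + 1.02g if 1.12 − 0.91g < L ≤ 1.32 − 1.02g; S̃ = L + 0.91g if 1 − (5/6)g < L ≤ 1.12 − 0.91g; and S̃ = the unique real solution of (1−g)S̃ + g·S̃³/6 = L if 0 ≤ L ≤ 1 − (5/6)g; is an approximate zero of f_{g,L} for all g ∈ (0,1) and L ∈ [0,∞). -/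
noncomputable section

/-- The hyperbolic Kepler function `f_{g,L}(S) = S - g·arcsinh(S) - L`. -/
def fhk (g L : ℝ) : ℝ → ℝ := fun S => S - g * Real.arsinh S - L

/-- `β(f,z) = |f(z)/f'(z)|`. -/
def betaFn (f : ℝ → ℝ) (z : ℝ) : ℝ := |f z / deriv f z|

/-- `γ(f,z) = sup_{k ≥ 2} |f^{(k)}(z)/(k!·f'(z))|^{1/(k-1)}`. -/
def gammaFn (f : ℝ → ℝ) (z : ℝ) : ℝ :=
  sSup {y : ℝ | ∃ k : ℕ, 2 ≤ k ∧
    y = |iteratedDeriv k f z / (Nat.factorial k * deriv f z)| ^ ((1 : ℝ) / ((k : ℝ) - 1))}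

/-- `α(f,z) = β(f,z)·γ(f,z)`. -/
def alphaFn (f : ℝ → ℝ) (z : ℝ) : ℝ := betaFn f z * gammaFn f z

/-- Smale's constant (improved by Wang–Han): `α₀ = 3 - 2√2`. -/
def alpha0 : ℝ := 3 - 2 * Real.sqrt 2

/-- `z` is an approximate zero of `f` when `α(f,z) < α₀`. -/
def ApproxZero (f : ℝ → ℝ) (z : ℝ) : Prop := alphaFn f z < alpha0

lemma ars_diff (n : ℕ) (x : ℝ) :
    HasDerivAt (iteratedDeriv n Real.arsinh) (iteratedDeriv (n+1) Real.arsinh x) x := by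
  have h : ContDiff ℝ ((n+1 : ℕ) : WithTop ℕ∞) Real.arsinh := Real.contDiff_arsinh
  have h2 := (h.differentiable_iteratedDeriv n (by exact_mod_cast Nat.lt_succ_self n)) x
  rw [iteratedDeriv_succ]
  exact h2.hasDerivAt

lemma ars_one (x : ℝ) : iteratedDeriv 1 Real.arsinh x = (√(1 + x ^ 2))⁻¹ := by
  rw [iteratedDeriv_one]
  exact (Real.hasDerivAt_arsinh x).deriv

lemma ars_rec (n : ℕ) : ∀ x : ℝ, (1 + x^2) * iteratedDeriv (n+2) Real.arsinh x
    + (2 * n + 1) * x * iteratedDeriv (n+1) Real.arsinh x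
    + (n:ℝ)^2 * iteratedDeriv n Real.arsinh x = 0 := by
  induction n with
  | zero =>
    intro x
    have hp : ∀ y : ℝ, 0 < 1 + y^2 := fun y => by positivity
    have hI : ∀ y : ℝ, (1 + y^2) * (iteratedDeriv 1 Real.arsinh y)^2 = 1 := by
      intro y
      rw [ars_one, inv_pow, Real.sq_sqrt (hp y).le]
      exact mul_inv_cancel₀ (hp y).ne'
    have h1 : HasDerivAt (fun y : ℝ => (1 + y^2) * (iteratedDeriv 1 Real.arsinh y)^2)
        ((2 * x) * (iteratedDeriv 1 Real.arsinh x)^2 + (1 + x^2) *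
          (2 * iteratedDeriv 1 Real.arsinh x * iteratedDeriv 2 Real.arsinh x)) x := by
      have ha : HasDerivAt (fun y : ℝ => 1 + y^2) (2 * x) x := by
        simpa using (hasDerivAt_pow 2 x).const_add 1
      have hb := (ars_diff 1 x).pow 2
      refine (ha.mul hb).congr_deriv ?_
      simp
    have h2 : HasDerivAt (fun y : ℝ => (1 + y^2) * (iteratedDeriv 1 Real.arsinh y)^2) 0 x := by
      have : (fun y : ℝ => (1 + y^2) * (iteratedDeriv 1 Real.arsinh y)^2) = fun _ => 1 := funext hI
      rw [this]; exact hasDerivAt_const _ _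
    have h3 := h1.unique h2
    have hne : iteratedDeriv 1 Real.arsinh x ≠ 0 := by
      rw [ars_one]; exact inv_ne_zero (Real.sqrt_pos.2 (hp x)).ne'
    have h4 : (2 * iteratedDeriv 1 Real.arsinh x) * ((1 + x^2) * iteratedDeriv 2 Real.arsinh x
      + x * iteratedDeriv 1 Real.arsinh x) = 0 := by linarith
    rcases mul_eq_zero.1 h4 with h | h
    · exact absurd (by linarith) hne
    · simp only [Nat.cast_zero, zero_add]; linarith
  | succ n ih =>
    intro x
    have ha : HasDerivAt (fun y : ℝ => 1 + y^2) (2 * x) x := by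
      simpa using (hasDerivAt_pow 2 x).const_add 1
    have hb : HasDerivAt (fun y : ℝ => (2 * (n:ℝ) + 1) * y) (2 * (n:ℝ) + 1) x := by
      simpa using (hasDerivAt_id x).const_mul (2 * (n:ℝ) + 1)
    have h1 := ((ha.mul (ars_diff (n+2) x)).add (hb.mul (ars_diff (n+1) x))).add
      ((ars_diff n x).const_mul ((n:ℝ)^2))
    have h2 := h1.congr_of_eventuallyEq (f₁ := fun _ => 0)
      (Filter.Eventually.of_forall fun y => by simpa using (ih y).symm)
    have h3 := h2.unique (hasDerivAt_const x (0:ℝ))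
    push_cast
    have e : n + 1 + 2 = n + 2 + 1 := rfl
    have e' : n + 1 + 1 = n + 2 := rfl
    rw [e, e']
    rw [e'] at h3
    linear_combination h3

lemma ars_bound (x : ℝ) (n : ℕ) :
    |iteratedDeriv (n+1) Real.arsinh x| ≤ n.factorial / (√(1 + x^2))^(n+1) := by
  set b : ℕ → ℝ := fun n => iteratedDeriv (n+1) Real.arsinh x / n.factorial with hb
  have hR : 0 < 1 + x^2 := by positivity
  set R := 1 + x^2 with hRd
  have hA : ∀ n, iteratedDeriv (n+1) Real.arsinh x = n.factorial * b n := by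
    intro n
    have : (n.factorial : ℝ) ≠ 0 := by positivity
    simp only [hb]; field_simp
  have hE : ∀ n : ℕ, R^n * ((R * b (n+1) + x * b n)^2 + b n ^2) ≤ 1 / R := by
    intro n
    induction n with
    | zero =>
      have h0 := ars_rec 0 x
      have e1 := hA 1
      have e0 := hA 0
      simp only [Nat.factorial, Nat.cast_zero, zero_add] at h0 e1 e0
      have e2 : iteratedDeriv 1 Real.arsinh x = b 0 := by rw [e0]; simp
      have e3 : iteratedDeriv 2 Real.arsinh x = b 1 := by
        have : iteratedDeriv 2 Real.arsinh x = _ := e1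
        rw [this]; simp
      rw [e2, e3] at h0
      have h1 : R * b 1 + x * b 0 = 0 := by rw [hRd]; linarith
      have h2 : b 0 ^2 = 1 / R := by
        rw [← e2, ars_one, inv_pow, Real.sq_sqrt hR.le, one_div]
      simp only [zero_add, pow_zero]
      rw [h1, h2]; simp
    | succ n ih =>
      refine le_trans ?_ ih
      have h0 := ars_rec (n+1) x
      rw [show n + 1 + 2 = (n+2)+1 from rfl, hA (n+2), hA (n+1), hA n] at h0
      simp only [Nat.factorial_succ] at h0
      push_cast at h0
      have hf : (n.factorial : ℝ) ≠ 0 := by positivity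
      have hn : (0:ℝ) < (n:ℝ) + 1 := by positivity
      have h1 : ((n.factorial : ℝ) * (n+1)) * (((n:ℝ)+2) * (R * b (n+2) + x * b (n+1))
        + (n+1) * (x * b (n+1) + b n)) = 0 := by
        rw [← hRd] at h0
        linear_combination h0
      have h2 : ((n:ℝ)+2) * (R * b (n+2) + x * b (n+1)) + (n+1) * (x * b (n+1) + b n) = 0 := by
        rcases mul_eq_zero.1 h1 with h | h
        · exact absurd h (by positivity)
        · exact h
      have h3 : (R * b (n+2) + x * b (n+1))^2 ≤ (x * b (n+1) + b n)^2 := by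
        have h4 : R * b (n+2) + x * b (n+1) = - (((n:ℝ)+1)/(n+2)) * (x * b (n+1) + b n) := by
          field_simp
          linarith
        have h5 : (((n:ℝ)+1)/(n+2))^2 ≤ 1 := by
          have : ((n:ℝ)+1)/(n+2) ≤ 1 := by rw [div_le_one (by positivity)]; linarith
          have h0 : 0 ≤ ((n:ℝ)+1)/(n+2) := by positivity
          nlinarith
        rw [h4, mul_pow, neg_sq]
        nlinarith [sq_nonneg (x * b (n+1) + b n)]
      have hRn : 0 < R^n := by positivity
      calc R^(n+1) * ((R * b (n+1+1) + x * b (n+1))^2 + b (n+1)^2)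
          ≤ R^(n+1) * ((x * b (n+1) + b n)^2 + b (n+1)^2) := by
            gcongr
        _ = _ := by
            rw [pow_succ, hRd]; ring
  have h := hE n
  have hs : 0 < √R := Real.sqrt_pos.2 hR
  have h1 : (|b n| * (√R)^(n+1))^2 ≤ 1^2 := by
    have e : (|b n| * (√R)^(n+1))^2 = R * (R^n * b n ^2) := by
      rw [mul_pow, sq_abs, ← pow_mul, mul_comm (n+1) 2, pow_mul, Real.sq_sqrt hR.le]; ring
    rw [e]
    have h2 : R^n * b n^2 ≤ 1 / R := by
      refine le_trans ?_ h
      have hRn : 0 < R^n := by positivity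
      have := sq_nonneg (R * b (n+1) + x * b n)
      nlinarith
    calc R * (R^n * b n^2) ≤ R * (1 / R) := by gcongr
      _ = 1^2 := by field_simp
  have h2 := abs_le_of_sq_le_sq h1 (by norm_num)
  rw [hA n, abs_mul, Nat.abs_cast, le_div_iff₀ (by positivity), mul_assoc]
  have : |b n| * (√R)^(n+1) ≤ 1 := (le_abs_self _).trans h2
  have hf : (0:ℝ) ≤ n.factorial := by positivity
  nlinarith

lemma fhk_hasDeriv (g L S : ℝ) : HasDerivAt (fhk g L) (1 - g * (√(1+S^2))⁻¹) S := by
  unfold fhk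
  exact (((hasDerivAt_id S).sub ((Real.hasDerivAt_arsinh S).const_mul g))).sub_const L

lemma fhk_iter (g L : ℝ) (n : ℕ) (S : ℝ) :
    iteratedDeriv (n+2) (fhk g L) S = - g * iteratedDeriv (n+2) Real.arsinh S := by
  have h : ∀ n : ℕ, iteratedDeriv (n+2) (fhk g L) = fun S => - g * iteratedDeriv (n+2) Real.arsinh S := by
    intro n
    induction n with
    | zero =>
      rw [iteratedDeriv_succ, iteratedDeriv_one]
      funext S
      have e : deriv (fhk g L) = fun S => 1 - g * iteratedDeriv 1 Real.arsinh S := by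
        funext S; rw [(fhk_hasDeriv g L S).deriv, ars_one]
      rw [e]
      have := ((ars_diff 1 S).const_mul g).const_sub 1
      rw [this.deriv]; ring
    | succ n ih =>
      rw [show n + 1 + 2 = (n+2)+1 from rfl, iteratedDeriv_succ, ih]
      funext S
      exact ((ars_diff (n+2) S).const_mul (-g)).deriv
  rw [h n]

lemma gamma_le (g L S : ℝ) (hg0 : 0 < g) (hr : g < √(1+S^2)) :
    gammaFn (fhk g L) S ≤ max 1 (g / (2 * (√(1+S^2) - g))) / √(1+S^2) := by
  unfold gammaFn
  set r := √(1+S^2) with hrd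
  have hr0 : 0 < r := hg0.trans hr
  have hrg : 0 < r - g := by linarith
  set M := max 1 (g / (2 * (r - g))) with hM
  have hM1 : 1 ≤ M := le_max_left _ _
  have hM2 : g / (2 * (r - g)) ≤ M := le_max_right _ _
  apply csSup_le
  · exact ⟨_, 2, le_rfl, rfl⟩
  rintro y ⟨k, hk, rfl⟩
  obtain ⟨n, rfl⟩ := Nat.exists_eq_add_of_le' hk
  rw [fhk_iter, (fhk_hasDeriv g L S).deriv, ← hrd]
  have hb := ars_bound S (n+1)
  rw [← hrd] at hb
  have hd : 1 - g * r⁻¹ = (r - g) / r := by field_simp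
  rw [hd]
  have hf : (0:ℝ) < (n+1).factorial := by positivity
  have key : |-g * iteratedDeriv (n+2) Real.arsinh S / (((n+2).factorial : ℝ) * ((r - g)/r))|
      ≤ (M / r)^(n+1) := by
    rw [abs_div, abs_mul, abs_neg, abs_of_pos hg0,
      abs_of_pos (show 0 < (((n+2).factorial : ℝ) * ((r - g)/r)) by positivity)]
    rw [div_le_iff₀ (by positivity)]
    calc g * |iteratedDeriv (n+2) Real.arsinh S| ≤ g * ((n+1).factorial / r^(n+1+1)) := by gcongr
      _ = (g / (2 * (r-g))) * (2 * (r - g) * (n+1).factorial / r^(n+2)) := by field_simp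
      _ ≤ M^(n+1) * (((n:ℝ) + 2) * (r-g) * (n+1).factorial / r^(n+2)) := by
          have : M ≤ M^(n+1) := le_self_pow₀ hM1 (by omega)
          gcongr
          · exact hM2.trans this
          · have : (0:ℝ) ≤ n := by positivity
            linarith
      _ = _ := by
          rw [Nat.factorial_succ (n+1), div_pow]
          push_cast
          field_simp
          ring
  have e : (1:ℝ) / (((n+2 : ℕ):ℝ) - 1) = ((n+1 : ℕ) : ℝ)⁻¹ := by
    push_cast; rw [one_div]; congr 1; ring
  rw [e]
  calc _ ≤ ((M / r)^(n+1)) ^ (((n+1 : ℕ) : ℝ)⁻¹) := by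
        apply Real.rpow_le_rpow (abs_nonneg _) key (by positivity)
    _ = M / r := Real.pow_rpow_inv_natCast (by positivity) (by omega)

lemma key (g L S H : ℝ) (hg0 : 0 < g) (hg1 : g < 1)
    (hf : |fhk g L S| ≤ g * H) (h1 : H ≤ 0.17 * (√(1+S^2) - 1))
    (h2 : H ≤ 0.34 * (√(1+S^2) - 1)^2) : ApproxZero (fhk g L) S := by
  have hr1 : 1 ≤ √(1+S^2) := by
    rw [Real.one_le_sqrt]; nlinarith [sq_nonneg S]
  have hG := gamma_le g L S hg0 (by linarith)
  unfold ApproxZero alphaFn betaFn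
  rw [(fhk_hasDeriv g L S).deriv]
  set r := √(1+S^2) with hr
  have hrg : 0 < r - g := by linarith
  have hr0 : 0 < r := by linarith
  have hH : 0 ≤ H := by
    have := (abs_nonneg _).trans hf
    exact nonneg_of_mul_nonneg_right this hg0
  have hd : 1 - g * r⁻¹ = (r - g) / r := by field_simp
  rw [hd, abs_div, abs_of_pos (show 0 < (r-g)/r by positivity)]
  have ha : (0.17:ℝ) < alpha0 := by
    unfold alpha0
    have : √2 < 1.415 := by
      rw [Real.sqrt_lt' (by norm_num)]; norm_num
    linarith
  refine lt_of_le_of_lt ?_ ha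
  have hG0 : 0 ≤ gammaFn (fhk g L) S := by
    apply Real.sSup_nonneg
    rintro y ⟨k, hk, rfl⟩
    positivity
  calc |fhk g L S| / ((r-g)/r) * gammaFn (fhk g L) S
      ≤ (g * H) / ((r-g)/r) * (max 1 (g / (2 * (r - g))) / r) := by gcongr
    _ = (g * H / (r-g)) * max 1 (g / (2 * (r - g))) := by field_simp
    _ ≤ 0.17 := by
      rcases max_choice 1 (g / (2 * (r - g))) with h | h <;> rw [h]
      · rw [mul_one, div_le_iff₀ hrg]
        nlinarith
      · rw [div_mul_div_comm, div_le_iff₀ (by positivity)]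
        have e1 : g * (r - 1) ≤ r - g := by nlinarith
        have e2 : (g * (r-1))^2 ≤ (r-g)^2 := by
          apply pow_le_pow_left₀ _ e1
          apply mul_nonneg hg0.le; linarith
        have : g^2 * H ≤ g^2 * (0.34 * (r-1)^2) := by gcongr
        nlinarith

lemma sqrt_lb (a m S : ℝ) (ha : 0 ≤ a) (h : a ≤ S) (hm : m^2 ≤ 1 + a^2) : m ≤ √(1+S^2) := by
  apply Real.le_sqrt_of_sq_le; nlinarith

lemma ars_ub (b S y x : ℝ) (p q : ℕ) (hq : q ≠ 0) (hb0 : 0 ≤ b) (h : S ≤ b) (hy : y = p / q)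
    (hx : 1 + b^2 ≤ (x - b)^2) (hxb : b ≤ x) (he : x^q ≤ 2.7182818283^p) : Real.arsinh S ≤ y := by
  have h1 : Real.arsinh S ≤ Real.arsinh b := Real.arsinh_le_arsinh.2 h
  refine h1.trans ?_
  have hs : √(1+b^2) ≤ x - b := by
    rw [Real.sqrt_le_left (by linarith)]; exact hx
  have hp : 0 < b + √(1+b^2) := by positivity
  unfold Real.arsinh
  rw [Real.log_le_iff_le_exp hp]
  refine le_trans (show _ ≤ x by linarith) ?_
  have hx0 : 0 ≤ x := by linarith
  refine le_of_pow_le_pow_left₀ hq (Real.exp_pos _).le ?_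
  rw [← Real.exp_nat_mul, hy, mul_div_cancel₀ _ (by exact_mod_cast hq)]
  rw [← mul_one (p:ℝ), Real.exp_nat_mul]
  refine he.trans ?_
  have := Real.exp_one_gt_d9
  gcongr

lemma ars_lb (a S y x : ℝ) (p q : ℕ) (hq : q ≠ 0) (ha0 : 0 ≤ a) (h : a ≤ S) (hy : y = p / q)
    (hx : (x - a)^2 ≤ 1 + a^2) (hx0 : 0 ≤ x) (he : 2.7182818286^p ≤ x^q) : y ≤ Real.arsinh S := by
  have h1 : Real.arsinh a ≤ Real.arsinh S := Real.arsinh_le_arsinh.2 h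
  refine le_trans ?_ h1
  have hs : x - a ≤ √(1+a^2) := Real.le_sqrt_of_sq_le hx
  have hp : 0 < a + √(1+a^2) := by positivity
  unfold Real.arsinh
  rw [Real.le_log_iff_exp_le hp]
  refine le_trans ?_ (show x ≤ _ by linarith)
  refine le_of_pow_le_pow_left₀ hq hx0 ?_
  rw [← Real.exp_nat_mul, hy, mul_div_cancel₀ _ (by exact_mod_cast hq)]
  rw [← mul_one (p:ℝ), Real.exp_nat_mul]
  refine le_trans ?_ he
  have := Real.exp_one_lt_d9
  gcongr

lemma fhk_lin (g L c D : ℝ) (hg : 0 < g) (h1 : Real.arsinh (L + c * g) ≤ c + D)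
    (h2 : c - D ≤ Real.arsinh (L + c * g)) : |fhk g L (L + c * g)| ≤ g * D := by
  unfold fhk
  have : L + c * g - g * Real.arsinh (L + c*g) - L = g * (c - Real.arsinh (L + c*g)) := by ring
  rw [this, abs_mul, abs_of_pos hg]
  gcongr
  rw [abs_le]; constructor <;> linarith

lemma ars_taylor (S : ℝ) (h0 : 0 ≤ S) (h1 : S ≤ 1) :
    S - S^3/6 ≤ Real.arsinh S ∧ Real.arsinh S ≤ S - S^3/6 + 0.075*S^5 - 0.022*S^7 := by
  have hc : Continuous Real.arsinh := Real.continuous_arsinh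
  have hin : ∀ x : ℝ, 0 < √(1+x^2) := fun x => Real.sqrt_pos.2 (by positivity)
  constructor
  · have hm : MonotoneOn (fun x : ℝ => Real.arsinh x - (x - x^3/6)) (Set.Icc 0 1) := by
      apply monotoneOn_of_hasDerivWithinAt_nonneg (f' := fun x => (√(1+x^2))⁻¹ - (1 - 3*x^2/6))
        (convex_Icc 0 1) (by fun_prop)
      · intro x hx
        apply HasDerivAt.hasDerivWithinAt
        have := (hasDerivAt_pow 3 x).div_const 6
        exact (Real.hasDerivAt_arsinh x).sub ((hasDerivAt_id x).sub (by simpa using this))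
      · intro x hx
        rw [interior_Icc] at hx
        obtain ⟨hx0, hx1⟩ := hx
        have hr : √(1+x^2) ≤ 1 + x^2/2 := by
          rw [Real.sqrt_le_left (by positivity)]; nlinarith [sq_nonneg (x^2)]
        rw [sub_nonneg, ← one_div, le_div_iff₀ (hin x)]
        have h3 : 0 ≤ 1 - 3*x^2/6 := by nlinarith
        nlinarith [mul_le_mul_of_nonneg_left hr h3, sq_nonneg (x^2)]
    have := hm (Set.left_mem_Icc.2 zero_le_one) ⟨h0, h1⟩ h0
    simp at this
    linarith
  · have hm : MonotoneOn (fun x : ℝ => (x - x^3/6 + 0.075*x^5 - 0.022*x^7) - Real.arsinh x) (Set.Icc 0 1) := by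
      apply monotoneOn_of_hasDerivWithinAt_nonneg
        (f' := fun x => (1 - 3*x^2/6 + 0.075*(5*x^4) - 0.022*(7*x^6)) - (√(1+x^2))⁻¹)
        (convex_Icc 0 1) (by fun_prop)
      · intro x hx
        apply HasDerivAt.hasDerivWithinAt
        have a3 := (hasDerivAt_pow 3 x).div_const 6
        have a5 := (hasDerivAt_pow 5 x).const_mul 0.075
        have a7 := (hasDerivAt_pow 7 x).const_mul 0.022
        exact (((((hasDerivAt_id x).sub (by simpa using a3))).add (by simpa using a5)).sub
          (by simpa using a7)).sub (Real.hasDerivAt_arsinh x)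
      · intro x hx
        rw [interior_Icc] at hx
        obtain ⟨hx0, hx1⟩ := hx
        rw [sub_nonneg, inv_le_iff_one_le_mul₀ (hin x)]
        have ht : 0 ≤ x^2 := sq_nonneg x
        have ht1 : x^2 ≤ 1 := by nlinarith
        have e4 : x^4 = (x^2)^2 := by ring
        have e6 : x^6 = (x^2)^3 := by ring
        have hq := Real.sq_sqrt (show 0 ≤ 1 + x^2 by positivity)
        rw [e4, e6]
        have hr := hin x
        generalize √(1+x^2) = r at *
        generalize x^2 = t at *
        have hD : 0 ≤ 1 - 3*t/6 + 0.075*(5*t^2) - 0.022*(7*t^3) := by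
          nlinarith [mul_nonneg (sq_nonneg t) (sub_nonneg.2 ht1)]
        rw [← one_le_sq_iff₀ (by positivity), mul_pow, hq]
        have h5 : 0 ≤ 0.317 - 0.388375*t + 0.179125*t^2 - 0.091784*t^3 + 0.023716*t^4 := by
          nlinarith [mul_nonneg (sq_nonneg t) (sub_nonneg.2 ht1), pow_nonneg ht 4]
        have h6 := mul_nonneg (pow_nonneg ht 3) h5
        linarith
    have := hm (Set.left_mem_Icc.2 zero_le_one) ⟨h0, h1⟩ h0
    simp at this
    linarith

lemma poly1 (t : ℝ) (h0 : 0 ≤ t) : (0.075 - 0.022 * t) * (2 + t/2)^2 ≤ 0.34 := by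
  have h3 := pow_nonneg h0 3
  have h4 := sq_nonneg (t - 124/101)
  have e : (0.075 - 0.022 * t) * (2 + t/2)^2 = 0.3 + 0.062*t - 0.02525*t^2 - 0.0055*t^3 := by ring
  rw [e]
  linarith

/-- Theorem 1.3: the piecewise-defined starter `S̃(g,L)` is an approximate zero of
`f_{g,L}` for all `g ∈ (0,1)` and `L ∈ [0,∞)`.  The starter is described by the
disjunction of the eight regions together with the value of `S̃` in each of them;
in the last region `S̃` is the (unique) real solution of the cubic
`(1-g)·S̃ + g·S̃³/6 = L`. -/
theorem starter_is_approx_zero (g L S : ℝ) (hg0 : 0 < g) (hg1 : g < 1) (hL : 0 ≤ L)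
    (hS :
      (4 - 1.9 * g < L ∧ S = L + 2.30 * g) ∨
      (2.74 - 1.56 * g < L ∧ L ≤ 4 - 1.9 * g ∧ S = L + 1.90 * g) ∨
      (2.01 - 1.33 * g < L ∧ L ≤ 2.74 - 1.56 * g ∧ S = L + 1.56 * g) ∨
      (1.60 - 1.16 * g < L ∧ L ≤ 2.01 - 1.33 * g ∧ S = L + 1.33 * g) ∨
      (1.32 - 1.02 * g < L ∧ L ≤ 1.60 - 1.16 * g ∧ S = L + 1.16 * g) ∨
      (1.12 - 0.91 * g < L ∧ L ≤ 1.32 - 1.02 * g ∧ S = L + 1.02 * g) ∨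
      (1 - 5 / 6 * g < L ∧ L ≤ 1.12 - 0.91 * g ∧ S = L + 0.91 * g) ∨
      (0 ≤ L ∧ L ≤ 1 - 5 / 6 * g ∧ (1 - g) * S + g * S ^ 3 / 6 = L)) :
    ApproxZero (fhk g L) S := by
  rcases hS with ⟨h1, rfl⟩ | h | h | h | h | h | h | ⟨_, h2, h3⟩
  · have hS4 : 4 ≤ L + 2.30 * g := by linarith
    have hlo := ars_lb 4 _ 1.8 8 9 5 (by norm_num) (by norm_num) hS4 (by norm_num) (by norm_num)
      (by norm_num) (by norm_num)
    have hr : L + 2.30 * g ≤ √(1 + (L + 2.30 * g)^2) := Real.le_sqrt_of_sq_le (by linarith)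
    have hup : Real.arsinh (L + 2.30 * g) ≤ 2.3 + 0.17 * (L + 2.30 * g - 1) := by
      generalize L + 2.30 * g = S at *
      have hs : √(1 + S^2) ≤ S + 1 := by
        rw [Real.sqrt_le_left (by linarith)]; nlinarith
      have hp : 0 < S + √(1 + S^2) := by linarith
      unfold Real.arsinh
      have e : S + √(1 + S^2) = 2^4 * ((S + √(1 + S^2)) / 16) := by ring
      rw [e, Real.log_mul (by norm_num) (by positivity), Real.log_pow]
      have := Real.log_le_sub_one_of_pos (show 0 < (S + √(1 + S^2)) / 16 by positivity)
      have := Real.log_two_lt_d9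
      push_cast
      linarith
    apply key g L _ (0.17 * (√(1 + (L + 2.30 * g)^2) - 1)) hg0 hg1 _ le_rfl
    · nlinarith
    · apply fhk_lin g L _ _ hg0 <;> linarith
  · obtain ⟨h1, h2, rfl⟩ := h
    have hlo := ars_lb 2.74 (L + 1.90 * g) (8/5) 5.6 8 5 (by norm_num) (by norm_num) (by linarith)
      (by norm_num) (by norm_num) (by norm_num) (by norm_num)
    have hup := ars_ub 4 (L + 1.90 * g) (11/5) 8.2 11 5 (by norm_num) (by norm_num) (by linarith)
      (by norm_num) (by norm_num) (by norm_num) (by norm_num)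
    have hr := sqrt_lb 2.74 2.9 (L + 1.90 * g) (by norm_num) (by linarith) (by norm_num)
    apply key g L _ 0.323 hg0 hg1
    · apply fhk_lin g L _ _ hg0 <;> linarith
    · linarith
    · nlinarith
  · obtain ⟨h1, h2, rfl⟩ := h
    have hlo := ars_lb 2.01 (L + 1.56 * g) (7/5) 4.25 7 5 (by norm_num) (by norm_num) (by linarith)
      (by norm_num) (by norm_num) (by norm_num) (by norm_num)
    have hup := ars_ub 2.74 (L + 1.56 * g) (7/4) 5.66 7 4 (by norm_num) (by norm_num) (by linarith)
      (by norm_num) (by norm_num) (by norm_num) (by norm_num)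
    have hr := sqrt_lb 2.01 2.24 (L + 1.56 * g) (by norm_num) (by linarith) (by norm_num)
    apply key g L _ 0.2 hg0 hg1
    · apply fhk_lin g L _ _ hg0 <;> linarith
    · linarith
    · nlinarith
  · obtain ⟨h1, h2, rfl⟩ := h
    have hlo := ars_lb 1.60 (L + 1.33 * g) (6/5) 3.48 6 5 (by norm_num) (by norm_num) (by linarith)
      (by norm_num) (by norm_num) (by norm_num) (by norm_num)
    have hup := ars_ub 2.01 (L + 1.33 * g) (73/50) 4.256 73 50 (by norm_num) (by norm_num) (by linarith)
      (by norm_num) (by norm_num) (by norm_num) (by norm_num)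
    have hr := sqrt_lb 1.60 1.88 (L + 1.33 * g) (by norm_num) (by linarith) (by norm_num)
    apply key g L _ 0.149 hg0 hg1
    · apply fhk_lin g L _ _ hg0 <;> linarith
    · linarith
    · nlinarith
  · obtain ⟨h1, h2, rfl⟩ := h
    have hlo := ars_lb 1.32 (L + 1.16 * g) (21/20) 2.97 21 20 (by norm_num) (by norm_num) (by linarith)
      (by norm_num) (by norm_num) (by norm_num) (by norm_num)
    have hup := ars_ub 1.60 (L + 1.16 * g) (63/50) 3.487 63 50 (by norm_num) (by norm_num) (by linarith)
      (by norm_num) (by norm_num) (by norm_num) (by norm_num)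
    have hr := sqrt_lb 1.32 1.65 (L + 1.16 * g) (by norm_num) (by linarith) (by norm_num)
    apply key g L _ 0.11 hg0 hg1
    · apply fhk_lin g L _ _ hg0 <;> linarith
    · linarith
    · nlinarith
  · obtain ⟨h1, h2, rfl⟩ := h
    have hlo := ars_lb 1.12 (L + 1.02 * g) (19/20) 2.62 19 20 (by norm_num) (by norm_num) (by linarith)
      (by norm_num) (by norm_num) (by norm_num) (by norm_num)
    have hup := ars_ub 1.32 (L + 1.02 * g) (11/10) 2.977 11 10 (by norm_num) (by norm_num) (by linarith)
      (by norm_num) (by norm_num) (by norm_num) (by norm_num)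
    have hr := sqrt_lb 1.12 1.5 (L + 1.02 * g) (by norm_num) (by linarith) (by norm_num)
    apply key g L _ 0.085 hg0 hg1
    · apply fhk_lin g L _ _ hg0 <;> linarith
    · linarith
    · nlinarith
  · obtain ⟨h1, h2, rfl⟩ := h
    have hlo := ars_lb 1 (L + 0.91 * g) (43/50) 2.41 43 50 (by norm_num) (by norm_num) (by linarith)
      (by norm_num) (by norm_num) (by norm_num) (by norm_num)
    have hup := ars_ub 1.12 (L + 0.91 * g) (121/125) 2.622 121 125 (by norm_num) (by norm_num) (by linarith)
      (by norm_num) (by norm_num) (by norm_num) (by norm_num)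
    have hr := sqrt_lb 1 1.414 (L + 0.91 * g) (by norm_num) (by linarith) (by norm_num)
    apply key g L _ 0.058 hg0 hg1
    · apply fhk_lin g L _ _ hg0 <;> linarith
    · linarith
    · nlinarith
  · have hS0 : 0 ≤ S := by
      by_contra hn
      push Not at hn
      have : 0 < (1 - g) + g * S^2 / 6 := by
        have : 0 < 1 - g := by linarith
        positivity
      nlinarith
    have hS1 : S ≤ 1 := by
      by_contra hn
      push Not at hn
      have : 1 < S^3 := one_lt_pow₀ hn (by norm_num)
      nlinarith
    obtain ⟨ht1, ht2⟩ := ars_taylor S hS0 hS1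
    have hS2 : S^2 ≤ 1 := by nlinarith
    have hr : 1 + S^2 / (2 + S^2/2) ≤ √(1 + S^2) := by
      apply Real.le_sqrt_of_sq_le
      have : S^2 / (2 + S^2/2) * (2 + S^2/2) = S^2 := by field_simp
      have h4 : S^2 / (2 + S^2/2) ≤ S^2/2 := by
        gcongr; linarith [sq_nonneg S]
      have h5 : 0 ≤ S^2 / (2 + S^2/2) := by positivity
      nlinarith
    have hu0 : S^2 * 0.4 ≤ S^2 / (2 + S^2/2) := by
      rw [le_div_iff₀ (by positivity)]
      nlinarith [sq_nonneg S]
    have hp3 : S^3 ≤ S^2 := pow_le_pow_of_le_one hS0 hS1 (by norm_num)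
    have hH0 : 0 ≤ 0.075 - 0.022 * S^2 := by linarith
    have hfac : 0.075*S^5 - 0.022*S^7 ≤ S^4 * (0.075 - 0.022 * S^2) := by
      have h6 := mul_nonneg (mul_nonneg (pow_nonneg hS0 4) hH0) (sub_nonneg.2 hS1)
      linarith
    apply key g L S (0.075*S^5 - 0.022*S^7) hg0 hg1
    · have e : fhk g L S = - (g * (Real.arsinh S - (S - S^3/6))) := by
        unfold fhk; rw [← h3]; ring
      rw [e, abs_neg, abs_mul, abs_of_pos hg0, abs_of_nonneg (by linarith)]
      apply mul_le_mul_of_nonneg_left _ hg0.le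
      linarith
    · have h9 : S^4 ≤ S^2 := pow_le_pow_of_le_one hS0 hS1 (by norm_num)
      have h10 : S^4 * (0.075 - 0.022 * S^2) ≤ S^2 * 0.068 := by
        have h11 := mul_nonneg (sq_nonneg S) (sub_nonneg.2 hS2)
        have h13 := mul_nonneg (sq_nonneg S) (sq_nonneg (S^2 - 1))
        linarith
      linarith
    · have h7 : S^4 * (0.075 - 0.022 * S^2) ≤ 0.34 * (S^2 / (2 + S^2/2))^2 := by
        rw [div_pow, ← mul_div_assoc, le_div_iff₀ (by positivity)]
        have h8 : (0.075 - 0.022 * S^2) * (2 + S^2/2)^2 ≤ 0.34 := poly1 _ (sq_nonneg S)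
        have := mul_le_mul_of_nonneg_left h8 (pow_nonneg hS0 4)
        linarith
      have h5 : 0 ≤ S^2 / (2 + S^2/2) := by positivity
      have h12 : (S^2 / (2 + S^2/2))^2 ≤ (√(1+S^2) - 1)^2 := by
        apply pow_le_pow_left₀ h5; linarith
      linarith
end
end

section
/- Let U be an open subset of ℝ² contained in (0,1)×[0,∞) whose closure contains the segment {1}×[0,ε] for some ε > 0. Then for every constant S₀ ≥ 0 there exists a point (g₀,L₀) ∈ U such that S₀ is not an approximate zero of f_{g₀,L₀}, i.e., α(f_{g₀,L₀}, S₀) ≥ α₀. -/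
noncomputable section

open Filter Topology

lemma fhk_hasDerivAt (g L S : ℝ) :
    HasDerivAt (fhk g L) (1 - g * (√(1 + S ^ 2))⁻¹) S := by
  unfold fhk
  exact ((hasDerivAt_id S).sub ((Real.hasDerivAt_arsinh S).const_mul g)).sub_const L

lemma fhk_deriv (g L : ℝ) : deriv (fhk g L) = fun S => 1 - g * (√(1 + S ^ 2))⁻¹ :=
  funext fun S => (fhk_hasDerivAt g L S).deriv

lemma fhk_analytic (g L S : ℝ) : AnalyticAt ℝ (fhk g L) S := by
  unfold fhk
  exact (analyticAt_id.sub (analyticAt_const.mul Real.analyticAt_arsinh)).sub analyticAt_const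

lemma fhk_deriv2 (g L S : ℝ) :
    iteratedDeriv 2 (fhk g L) S = g * (S / ((1 + S ^ 2) * √(1 + S ^ 2))) := by
  rw [iteratedDeriv_succ, iteratedDeriv_one, fhk_deriv]
  have hp : 0 < 1 + S ^ 2 := by positivity
  have h1 : HasDerivAt (fun S : ℝ => 1 + S ^ 2) (2 * S) S := by
    simpa using (hasDerivAt_pow 2 S).const_add 1
  have h2 := (((h1.sqrt hp.ne').inv (Real.sqrt_pos.2 hp).ne').const_mul g).const_sub 1
  have h3 := h2.deriv
  simp only [Pi.inv_apply] at h3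
  rw [show (fun S : ℝ => 1 - g * (√(1 + S ^ 2))⁻¹) = fun x => 1 - g * (fun S : ℝ => √(1 + S ^ 2))⁻¹ x from rfl, h2.deriv]
  rw [Real.sq_sqrt hp.le]
  have := (Real.sqrt_pos.2 hp).ne'
  field_simp

lemma no_conv (g L S r C : ℝ) (hg : 0 < g) (hr : √(1 + S ^ 2) < r)
    (hb : ∀ n : ℕ, |iteratedDeriv n (fhk g L) S / (n.factorial : ℝ)| * r ^ n ≤ C) : False := by
  obtain ⟨r', hr'⟩ : ∃ r' : NNReal, (r' : ℝ) = r :=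
    ⟨⟨r, (Real.sqrt_nonneg _).trans hr.le⟩, rfl⟩
  set a : ℕ → ℝ := fun n => iteratedDeriv n (fhk g L) S / (n.factorial : ℝ) with ha
  have hr0 : 0 < r := lt_of_le_of_lt (Real.sqrt_nonneg _) hr
  set q : FormalMultilinearSeries ℂ ℂ ℂ :=
    FormalMultilinearSeries.ofScalars ℂ (fun n => (a n : ℂ)) with hq
  have hrad : (r' : ENNReal) ≤ q.radius := by
    apply q.le_radius_of_bound C
    intro n
    rw [hq, FormalMultilinearSeries.ofScalars_norm]
    rw [hr']
    simpa using hb n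
  have hpos : 0 < q.radius := lt_of_lt_of_le (by rw [← hr'] at hr0; exact_mod_cast hr0) hrad
  have hG := q.hasFPowerSeriesOnBall hpos
  have hball : Metric.ball (0 : ℂ) r ⊆ Metric.eball (0 : ℂ) q.radius := by
    intro z hz
    refine Metric.eball_subset_eball hrad ?_
    rw [Metric.eball_coe, hr']
    exact hz
  have hGa : AnalyticOnNhd ℂ q.sum (Metric.ball 0 r) := hG.analyticOnNhd.mono hball
  have hGd : AnalyticOnNhd ℂ (deriv q.sum) (Metric.ball 0 r) := hGa.deriv
  have hreal := (fhk_analytic g L S).hasFPowerSeriesAt.eventually_hasSum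
  have heq : ∀ᶠ y : ℝ in 𝓝 0, q.sum (y : ℂ) = ((fhk g L (S + y) : ℝ) : ℂ) := by
    filter_upwards [hreal] with y hy
    have := Complex.hasSum_ofReal.2 hy
    rw [← this.tsum_eq]
    unfold FormalMultilinearSeries.sum
    congr 1
    ext n
    rw [hq, FormalMultilinearSeries.ofScalars_apply_eq, FormalMultilinearSeries.ofScalars_apply_eq]
    simp [ha]
  have hder : ∀ᶠ y : ℝ in 𝓝 0, (1 - deriv q.sum (y : ℂ)) ^ 2 * (1 + (S + (y : ℂ)) ^ 2) - (g : ℂ) ^ 2 = 0 := by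
    filter_upwards [heq.eventually_nhds, Metric.ball_mem_nhds (0 : ℝ) hr0] with y hy hyr
    have hyr' : (y : ℂ) ∈ Metric.ball (0 : ℂ) r := by simpa using hyr
    have h1 := (hGa _ hyr').differentiableAt.hasDerivAt.comp_ofReal
    have h2 : HasDerivAt (fun y : ℝ => fhk g L (S + y)) (1 - g * (√(1 + (S + y) ^ 2))⁻¹) y :=
      (fhk_hasDerivAt g L (S + y)).comp_const_add S y
    have h3 := h2.ofReal_comp
    have h4 := h1.unique (h3.congr_of_eventuallyEq hy)
    rw [h4]
    have hp : 0 < 1 + (S + y) ^ 2 := by positivity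
    have hs := (Real.sqrt_pos.2 hp).ne'
    have : (1 - (1 - g * (√(1 + (S + y) ^ 2))⁻¹)) ^ 2 * (1 + (S + y) ^ 2) - g ^ 2 = 0 := by
      have := Real.sq_sqrt hp.le
      field_simp
      rw [this]; ring
    exact_mod_cast this
  have hK : AnalyticOnNhd ℂ (fun w : ℂ => (1 - deriv q.sum w) ^ 2 * (1 + (S + w) ^ 2) - (g : ℂ) ^ 2)
      (Metric.ball 0 r) := by
    intro w hw
    have := hGd w hw
    fun_prop
  have hfreq : ∃ᶠ w in 𝓝[≠] (0 : ℂ), (1 - deriv q.sum w) ^ 2 * (1 + (S + w) ^ 2) - (g : ℂ) ^ 2 = 0 := by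
    have ht : Tendsto (fun y : ℝ => (y : ℂ)) (𝓝[≠] 0) (𝓝[≠] 0) := by
      refine tendsto_nhdsWithin_iff.2 ⟨?_, ?_⟩
      · have : Tendsto (fun y : ℝ => (y : ℂ)) (𝓝 0) (𝓝 ((0 : ℝ) : ℂ)) :=
          Complex.continuous_ofReal.tendsto 0
        rw [Complex.ofReal_zero] at this
        exact this.mono_left nhdsWithin_le_nhds
      · filter_upwards [self_mem_nhdsWithin] with y hy
        simpa using hy
    exact ht.frequently (hder.filter_mono nhdsWithin_le_nhds).frequently
  have hI : (Complex.I - S : ℂ) ∈ Metric.ball (0 : ℂ) r := by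
    rw [mem_ball_zero_iff]
    refine lt_of_eq_of_lt ?_ hr
    rw [Complex.norm_def, Complex.normSq_apply]
    congr 1
    simp
    ring
  have h0 := hK.eqOn_zero_of_preconnected_of_frequently_eq_zero
    (convex_ball (0 : ℂ) r).isPreconnected (Metric.mem_ball_self hr0) hfreq hI
  simp at h0
  exact hg.ne' h0

lemma deriv_pos' (g S : ℝ) (hg1 : g < 1) : 0 < 1 - g * (√(1 + S ^ 2))⁻¹ := by
  have h1 : 1 ≤ √(1 + S ^ 2) := by
    rw [Real.one_le_sqrt]; nlinarith [sq_nonneg S]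
  have h2 : 0 < √(1 + S ^ 2) := by linarith
  rw [← div_eq_mul_inv, sub_pos, div_lt_one h2]
  linarith

lemma gamma_bdd (g L S : ℝ) : BddAbove {y : ℝ | ∃ k : ℕ, 2 ≤ k ∧
    y = |iteratedDeriv k (fhk g L) S / (Nat.factorial k * deriv (fhk g L) S)| ^ ((1 : ℝ) / ((k : ℝ) - 1))} := by
  have hs := (fhk_analytic g L S).hasFPowerSeriesAt
  obtain ⟨C, r, hC, hr, hb⟩ := FormalMultilinearSeries.le_mul_pow_of_radius_pos _ hs.radius_pos
  set d := |deriv (fhk g L) S|⁻¹ with hd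
  have hd0 : 0 ≤ d := by positivity
  set M := 1 + r + C * d with hM
  have hCd : 0 ≤ C * d := by positivity
  refine ⟨M ^ 3, ?_⟩
  rintro y ⟨k, hk, rfl⟩
  have hM1 : 1 ≤ M := by linarith
  have h1 : |iteratedDeriv k (fhk g L) S / (Nat.factorial k * deriv (fhk g L) S)| ≤ M ^ (3 * (k - 1)) := by
    have := hb k
    rw [FormalMultilinearSeries.ofScalars_norm, Real.norm_eq_abs] at this
    rw [← div_div, abs_div, div_eq_mul_inv]
    calc _ ≤ (C * r ^ k) * d := by gcongr
      _ = (C * d) * r ^ k := by ring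
      _ ≤ M * M ^ k := by gcongr <;> linarith
      _ = M ^ (k + 1) := by ring
      _ ≤ _ := pow_le_pow_right₀ hM1 (by omega)
  have hk1 : (0 : ℝ) < (k : ℝ) - 1 := by
    have : (2 : ℝ) ≤ k := by exact_mod_cast hk
    linarith
  calc _ ≤ (M ^ (3 * (k - 1))) ^ ((1 : ℝ) / ((k : ℝ) - 1)) :=
        Real.rpow_le_rpow (abs_nonneg _) h1 (by positivity)
    _ = M ^ 3 := by
      rw [pow_mul, show ((k : ℝ) - 1) = ((k - 1 : ℕ) : ℝ) by
        rw [Nat.cast_sub (by omega)]; simp, one_div]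
      exact Real.pow_rpow_inv_natCast (by positivity) (by omega)

lemma gamma_ge (g L S : ℝ) (k : ℕ) (hk : 2 ≤ k) :
    |iteratedDeriv k (fhk g L) S / (Nat.factorial k * deriv (fhk g L) S)| ^ ((1 : ℝ) / ((k : ℝ) - 1))
      ≤ gammaFn (fhk g L) S :=
  le_csSup (gamma_bdd g L S) ⟨k, hk, rfl⟩

lemma gamma_ge2 (g L S : ℝ) :
    |g * (S / ((1 + S ^ 2) * √(1 + S ^ 2))) / (2 * (1 - g * (√(1 + S ^ 2))⁻¹))|
      ≤ gammaFn (fhk g L) S := by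
  have := gamma_ge g L S 2 le_rfl
  rw [fhk_deriv2, fhk_deriv] at this
  norm_num at this
  simpa using this

lemma gamma_ge_inf (g L S : ℝ) (hg : 0 < g) (hg1 : g < 1) :
    (√(1 + S ^ 2))⁻¹ ≤ gammaFn (fhk g L) S := by
  by_contra! hlt
  set γ := gammaFn (fhk g L) S with hγ
  have hγ0 : 0 ≤ γ := (abs_nonneg _).trans (gamma_ge2 g L S)
  have hsp : 0 < √(1 + S ^ 2) := Real.sqrt_pos.2 (by positivity)
  obtain ⟨ρ, hρ1, hρ2⟩ := exists_between hlt
  have hρ0 : 0 < ρ := by linarith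
  have hD : 0 < deriv (fhk g L) S := by rw [fhk_deriv]; exact deriv_pos' g S hg1
  set D := deriv (fhk g L) S
  refine no_conv g L S ρ⁻¹ (|fhk g L S| + D * ρ⁻¹) hg ((lt_inv_comm₀ hρ0 hsp).1 hρ2) ?_
  intro n
  rcases Nat.lt_or_ge n 2 with hn | hn
  · interval_cases n
    · simp; positivity
    · simp [iteratedDeriv_one]
      rw [abs_of_pos hD]
      have := abs_nonneg (fhk g L S)
      linarith
  · have h := gamma_ge g L S n hn
    have hk : ((n : ℝ) - 1) = ((n - 1 : ℕ) : ℝ) := by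
      rw [Nat.cast_sub (by omega)]; simp
    rw [hk, one_div] at h
    have h2 : |iteratedDeriv n (fhk g L) S / (Nat.factorial n * D)| ≤ ρ ^ (n - 1) := by
      rw [← Real.rpow_inv_natCast_pow (abs_nonneg (iteratedDeriv n (fhk g L) S / (Nat.factorial n * D)))
        (show n - 1 ≠ 0 by omega)]
      exact pow_le_pow_left₀ (by positivity) (h.trans hρ1.le) _
    rw [← div_div, abs_div, abs_of_pos hD, div_le_iff₀ hD] at h2
    have h3 : ρ ^ (n - 1) * ρ⁻¹ ^ n = ρ⁻¹ := by
      obtain ⟨m, rfl⟩ : ∃ m, n = m + 1 := ⟨n - 1, by omega⟩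
      simp only [Nat.add_sub_cancel, pow_succ, inv_pow]
      field_simp
    calc _ ≤ (ρ ^ (n - 1) * D) * ρ⁻¹ ^ n := by gcongr
      _ = D * (ρ ^ (n - 1) * ρ⁻¹ ^ n) := by ring
      _ = D * ρ⁻¹ := by rw [h3]
      _ ≤ _ := by have := abs_nonneg (fhk g L S); linarith

lemma alpha0_lt : alpha0 < 0.172 := by
  unfold alpha0
  have : (1.414 : ℝ) < √2 := Real.lt_sqrt_of_sq_lt (by norm_num)
  linarith

lemma num_inf (t : ℝ) (ht : 1 ≤ t) : 0.172 * (Real.cosh t - 1) < Real.sinh t - t := by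
  rw [Real.cosh_eq, Real.sinh_eq]
  have h1 : Real.exp 1 * t ≤ Real.exp t := by
    have := Real.add_one_le_exp (t - 1)
    rw [Real.exp_sub, le_div_iff₀ (Real.exp_pos 1)] at this
    linarith
  have h2 : Real.exp (-t) * Real.exp 1 ≤ 1 := by
    rw [← Real.exp_add, Real.exp_le_one_iff]; linarith
  have h3 := Real.exp_one_gt_d9
  have h4 := Real.exp_pos (-t)
  have h5 : Real.exp (-t) ≤ 0.37 := by nlinarith
  nlinarith

lemma num_two (t : ℝ) (h0 : 0 < t) (ht : t ≤ 1) :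
    0.344 * Real.cosh t * (Real.cosh t - 1) ^ 2 < (Real.sinh t - t) * Real.sinh t := by
  have hs : t + t ^ 3 / 6 ≤ Real.sinh t := by
    have := sum_le_hasSum (Finset.range 2) (fun i _ => by positivity) (Real.hasSum_sinh t)
    norm_num [Finset.sum_range_succ, Nat.factorial] at this
    exact this
  have hc : Real.cosh t ≤ 1 + t ^ 2 * 0.5521 := by
    have ha : |t| ≤ 1 := by rw [abs_of_pos h0]; exact ht
    have e1 := abs_le.1 (Real.exp_bound ha (n := 4) (by norm_num))
    have e2 := abs_le.1 (Real.exp_bound (x := -t) (by rwa [abs_neg]) (n := 4) (by norm_num))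
    rw [abs_of_pos h0] at e1
    rw [abs_neg, abs_of_pos h0] at e2
    simp [Finset.sum_range_succ, Nat.factorial] at e1 e2
    rw [Real.cosh_eq]
    have : t ^ 4 ≤ t ^ 2 := pow_le_pow_of_le_one h0.le ht (by norm_num)
    nlinarith [e1.2, e2.2]
  have h1 := Real.one_le_cosh t
  have ht2 : t ^ 2 ≤ 1 := by nlinarith
  calc _ ≤ 0.344 * 1.5521 * (t ^ 2 * 0.5521) ^ 2 := by
        gcongr
        · linarith
        · linarith
    _ < t ^ 3 / 6 * t := by
        have : 0 < t ^ 4 := by positivity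
        nlinarith
    _ ≤ _ := by
        have : 0 ≤ t ^ 3 / 6 := by positivity
        gcongr <;> linarith

lemma beta_eq (g L S : ℝ) : betaFn (fhk g L) S =
    |(S - g * Real.arsinh S - L) / (1 - g * (√(1 + S ^ 2))⁻¹)| := by
  unfold betaFn
  rw [fhk_deriv]; rfl

/-- Theorem 1.5: if `U ⊆ (0,1)×[0,∞)` is open and its closure contains the segment
`{1}×[0,ε]` for some `ε > 0`, then no constant starter `S₀ ≥ 0` is an approximate
zero of `f_{g,L}` on all of `U`: there is `(g₀,L₀) ∈ U` with `α(f_{g₀,L₀},S₀) ≥ α₀`. -/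
theorem no_constant_starter_near_corner (U : Set (ℝ × ℝ)) (hU : IsOpen U)
    (hUsub : U ⊆ Set.Ioo (0 : ℝ) 1 ×ˢ Set.Ici (0 : ℝ))
    (ε : ℝ) (hε : 0 < ε)
    (hcl : ({(1 : ℝ)} : Set ℝ) ×ˢ Set.Icc (0 : ℝ) ε ⊆ closure U)
    (S₀ : ℝ) (hS₀ : 0 ≤ S₀) :
    ∃ p ∈ U, alpha0 ≤ alphaFn (fhk p.1 p.2) S₀ := by
  have key : ∀ L₀ ∈ Set.Icc (0 : ℝ) ε, ∀ P : ℝ × ℝ → Prop, (∀ᶠ p in 𝓝 ((1 : ℝ), L₀), P p) →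
      ∃ p ∈ U, P p := by
    intro L₀ hL P hP
    have hm : ((1 : ℝ), L₀) ∈ closure U := hcl ⟨rfl, hL⟩
    obtain ⟨p, hp, hpU⟩ := ((mem_closure_iff_frequently.1 hm).and_eventually hP).exists
    exact ⟨p, hp, hpU⟩
  have hα := alpha0_lt
  rcases hS₀.eq_or_lt with h0 | h0
  · subst h0
    have hev : ∀ᶠ p : ℝ × ℝ in 𝓝 ((1 : ℝ), ε), 1 - p.1 < p.2 := by
      apply ContinuousAt.eventually_lt (by fun_prop) (by fun_prop)
      simpa using hε
    obtain ⟨⟨g, L⟩, hp, h⟩ := key ε ⟨hε.le, le_rfl⟩ _ hev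
    refine ⟨_, hp, ?_⟩
    obtain ⟨⟨hg, hg1⟩, hL⟩ := hUsub hp
    simp only [Set.mem_Ici] at hg hg1 hL h ⊢
    have hγ := gamma_ge_inf g L 0 hg hg1
    have hβ : 1 ≤ betaFn (fhk g L) 0 := by
      rw [beta_eq]
      have : 0 < 1 - g := by linarith
      simp only [Real.arsinh_zero]
      norm_num
      rw [abs_div, abs_of_pos this, le_div_iff₀ this]
      rw [abs_neg]
      exact (by linarith : 1 * (1 - g) ≤ L).trans (le_abs_self L)
    simp at hγ
    unfold alphaFn
    nlinarith
  · set t := Real.arsinh S₀ with ht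
    have ht0 : 0 < t := Real.arsinh_pos_iff.2 h0
    have hS : S₀ = Real.sinh t := (Real.sinh_arsinh S₀).symm
    have hc : √(1 + S₀ ^ 2) = Real.cosh t := (Real.cosh_arsinh S₀).symm
    have hc1 : 1 < Real.cosh t := Real.one_lt_cosh.2 ht0.ne'
    have hcp : 0 < Real.cosh t := by linarith
    have hD : 0 < 1 - 1 * (Real.cosh t)⁻¹ := by
      rw [one_mul, sub_pos]; exact inv_lt_one_of_one_lt₀ hc1
    have hst : 0 < Real.sinh t - t := sub_pos.2 (Real.self_lt_sinh_iff.2 ht0)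
    have hsp : 0 < Real.sinh t := by linarith
    have hcs : 1 + S₀ ^ 2 = Real.cosh t ^ 2 := by rw [hS, Real.cosh_sq]; ring
    rcases le_total 1 t with h1 | h1
    · have hev : ∀ᶠ p : ℝ × ℝ in 𝓝 ((1 : ℝ), (0 : ℝ)), alpha0 <
          |(S₀ - p.1 * t - p.2) / (1 - p.1 * (Real.cosh t)⁻¹)| * (Real.cosh t)⁻¹ := by
        apply ContinuousAt.eventually_lt continuousAt_const
        · have : (1 - ((1 : ℝ), (0 : ℝ)).1 * (Real.cosh t)⁻¹) ≠ 0 := hD.ne'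
          fun_prop (disch := assumption)
        · refine hα.trans ?_
          simp only [sub_zero]
          rw [hS, one_mul, abs_of_pos (div_pos hst hD)]
          have := num_inf t h1
          have e : (Real.sinh t - t) / (1 - 1 * (Real.cosh t)⁻¹) * (Real.cosh t)⁻¹
              = (Real.sinh t - t) / (Real.cosh t - 1) := by
            have : Real.cosh t - 1 ≠ 0 := by linarith
            field_simp
          rw [e, lt_div_iff₀ (by linarith)]
          exact this
      obtain ⟨⟨g, L⟩, hp, h⟩ := key 0 ⟨le_rfl, hε.le⟩ _ hev
      refine ⟨_, hp, h.le.trans ?_⟩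
      obtain ⟨⟨hg, hg1⟩, hL⟩ := hUsub hp
      have hγ := gamma_ge_inf g L S₀ hg hg1
      unfold alphaFn
      rw [beta_eq]
      rw [hc] at hγ ⊢
      exact mul_le_mul_of_nonneg_left hγ (abs_nonneg _)
    · have hev : ∀ᶠ p : ℝ × ℝ in 𝓝 ((1 : ℝ), (0 : ℝ)), alpha0 <
          |(S₀ - p.1 * t - p.2) / (1 - p.1 * (Real.cosh t)⁻¹)| *
          |p.1 * (S₀ / (Real.cosh t ^ 2 * Real.cosh t)) / (2 * (1 - p.1 * (Real.cosh t)⁻¹))| := by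
        apply ContinuousAt.eventually_lt continuousAt_const
        · have : (1 - ((1 : ℝ), (0 : ℝ)).1 * (Real.cosh t)⁻¹) ≠ 0 := hD.ne'
          have : (2 * (1 - ((1 : ℝ), (0 : ℝ)).1 * (Real.cosh t)⁻¹)) ≠ 0 := by simpa using hD.ne'
          fun_prop (disch := assumption)
        · refine hα.trans ?_
          simp only [sub_zero]
          rw [hS, one_mul, abs_of_pos (div_pos hst hD), abs_of_pos (by positivity)]
          have := num_two t ht0 h1
          have hne : 0 < Real.cosh t - 1 := by linarith
          have e : (Real.sinh t - t) / (1 - 1 * (Real.cosh t)⁻¹) *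
              (1 * (Real.sinh t / (Real.cosh t ^ 2 * Real.cosh t)) / (2 * (1 - 1 * (Real.cosh t)⁻¹)))
              = (Real.sinh t - t) * Real.sinh t / (2 * Real.cosh t * (Real.cosh t - 1) ^ 2) := by
            have := hne.ne'
            field_simp
          rw [e, lt_div_iff₀ (by positivity)]
          linarith
      obtain ⟨⟨g, L⟩, hp, h⟩ := key 0 ⟨le_rfl, hε.le⟩ _ hev
      refine ⟨_, hp, h.le.trans ?_⟩
      have hγ := gamma_ge2 g L S₀
      unfold alphaFn
      rw [beta_eq]
      rw [hc, hcs] at hγ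
      rw [hc]
      exact mul_le_mul_of_nonneg_left hγ (abs_nonneg _)
end
end

section
/- For every S₀ > 0, the constant starter S̃ = S₀ is an approximate zero of f_{g,L} for all (g,L) in the stripe R₃(S₀) = {(g,L) : 0 < g < 1, S₀ − g·arcsinh(S₀) − Δ(S₀) < L < S₀ − g·arcsinh(S₀) + Δ(S₀)}. -/
noncomputable section

/-- The half-width `Δ(S₀)` of the stripe `R₃(S₀)` of Theorem 3.1. -/
def Delta (S₀ : ℝ) : ℝ :=
  if S₀ ≤ Real.sqrt 7 / 3 then
    Real.sqrt 3 * alpha0 * S₀ ^ 3 * Real.sqrt (1 + S₀ ^ 2) /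
      (2 * (Real.sqrt (1 + S₀ ^ 2) + 1) ^ ((3 : ℝ) / 2))
  else
    alpha0 * S₀ * min 1 S₀ * Real.sqrt (1 + S₀ ^ 2) /
      (2 * (Real.sqrt (1 + S₀ ^ 2) + 1))

/-- The coupled polynomial recursion (Legendre-type) for derivatives of `(1+S²)^(-1/2)`. -/
def ptPair : ℕ → ℝ → ℝ × ℝ
  | 0, _ => (1, 0)
  | n + 1, S => (S * (ptPair n S).1 - (ptPair n S).2 / ((n : ℝ) + 1),
      ((n : ℝ) + 1) * (ptPair n S).1 + S * (ptPair n S).2)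

lemma ptPair_deriv (n : ℕ) (S : ℝ) :
    HasDerivAt (fun x => (ptPair n x).1)
      ((n * S * (ptPair n S).1 + (ptPair n S).2) / (1 + S ^ 2)) S ∧
    HasDerivAt (fun x => (ptPair n x).2)
      (((n + 1) * S * (ptPair n S).2 - n * (n + 1) * (ptPair n S).1) / (1 + S ^ 2)) S := by
  induction n with
  | zero =>
    simp only [ptPair]
    constructor
    · simpa using hasDerivAt_const S (1 : ℝ)
    · simpa using hasDerivAt_const S (0 : ℝ)
  | succ n ih =>
    obtain ⟨h1, h2⟩ := ih
    have hS : (1 + S ^ 2) ≠ 0 := by positivity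
    have hn : ((n : ℝ) + 1) ≠ 0 := by positivity
    simp only [ptPair]
    constructor
    · refine (((hasDerivAt_id S).mul h1).sub (h2.div_const ((n : ℝ) + 1))).congr_deriv ?_
      simp only [id]
      push_cast
      field_simp
      ring
    · refine ((h1.const_mul ((n : ℝ) + 1)).add ((hasDerivAt_id S).mul h2)).congr_deriv ?_
      simp only [id]
      push_cast
      field_simp
      ring

lemma ptPair_bound (n : ℕ) (S : ℝ) :
    (ptPair n S).1 ^ 2 ≤ (1 + S ^ 2) ^ n ∧
    (n : ℝ) ^ 2 * (ptPair n S).1 ^ 2 + (ptPair n S).2 ^ 2 ≤ (n : ℝ) ^ 2 * (1 + S ^ 2) ^ n := by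
  induction n with
  | zero => simp [ptPair]
  | succ n ih =>
    obtain ⟨h1, h2⟩ := ih
    have hn : (0 : ℝ) < (n : ℝ) + 1 := by positivity
    have hn0 : (0 : ℝ) ≤ (n : ℝ) := by positivity
    have key : ((n : ℝ) + 1) ^ 2 * (ptPair (n + 1) S).1 ^ 2 + (ptPair (n + 1) S).2 ^ 2
        ≤ ((n : ℝ) + 1) ^ 2 * (1 + S ^ 2) ^ (n + 1) := by
      have e : ((n : ℝ) + 1) ^ 2 * (ptPair (n + 1) S).1 ^ 2 + (ptPair (n + 1) S).2 ^ 2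
          = (1 + S ^ 2) * (((n : ℝ) + 1) ^ 2 * (ptPair n S).1 ^ 2 + (ptPair n S).2 ^ 2) := by
        simp only [ptPair]
        field_simp
        ring
      rw [e, pow_succ (1 + S ^ 2) n]
      have h3 : ((n : ℝ) + 1) ^ 2 * (ptPair n S).1 ^ 2 + (ptPair n S).2 ^ 2
          ≤ ((n : ℝ) + 1) ^ 2 * (1 + S ^ 2) ^ n := by
        have := mul_le_mul_of_nonneg_left h1 (by positivity : (0 : ℝ) ≤ 2 * n + 1)
        nlinarith
      have := mul_le_mul_of_nonneg_left h3 (by positivity : (0 : ℝ) ≤ 1 + S ^ 2)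
      linarith
    refine ⟨?_, by push_cast; exact key⟩
    have h4 : ((n : ℝ) + 1) ^ 2 * (ptPair (n + 1) S).1 ^ 2
        ≤ ((n : ℝ) + 1) ^ 2 * (1 + S ^ 2) ^ (n + 1) := by
      nlinarith [sq_nonneg (ptPair (n + 1) S).2]
    exact le_of_mul_le_mul_left h4 (by positivity)

lemma quot_deriv (n : ℕ) (S : ℝ) :
    HasDerivAt (fun x => (ptPair n x).1 / Real.sqrt (1 + x ^ 2) ^ (2 * n + 1))
      (-((n : ℝ) + 1) * (ptPair (n + 1) S).1 / Real.sqrt (1 + S ^ 2) ^ (2 * (n + 1) + 1)) S := by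
  have hpos : (0 : ℝ) < 1 + S ^ 2 := by positivity
  have hr : 0 < Real.sqrt (1 + S ^ 2) := Real.sqrt_pos.2 hpos
  have hsq : 1 + S ^ 2 = Real.sqrt (1 + S ^ 2) ^ 2 := (Real.sq_sqrt hpos.le).symm
  have h1 : HasDerivAt (fun x : ℝ => 1 + x ^ 2) (2 * S) S := by
    simpa using ((hasDerivAt_id S).pow 2).const_add 1
  have h2 := (h1.sqrt hpos.ne').pow (2 * n + 1)
  refine ((ptPair_deriv n S).1.div h2 (pow_pos hr _).ne').congr_deriv ?_
  simp only [ptPair, Pi.pow_apply]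
  have hn : ((n : ℝ) + 1) ≠ 0 := by positivity
  rw [show 2 * n + 1 - 1 = 2 * n by omega]
  generalize hrr : Real.sqrt (1 + S ^ 2) = r at *
  rw [hsq]
  push_cast
  field_simp
  ring

lemma fhk_iter_s16 (g L : ℝ) (n : ℕ) :
    iteratedDeriv (n + 1) (fhk g L) = fun S => (if n = 0 then 1 else 0) -
      g * ((-1) ^ n * (Nat.factorial n : ℝ) *
        ((ptPair n S).1 / Real.sqrt (1 + S ^ 2) ^ (2 * n + 1))) := by
  induction n with
  | zero =>
    funext S
    rw [zero_add, iteratedDeriv_one]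
    have h : HasDerivAt (fhk g L) (1 - g * (Real.sqrt (1 + S ^ 2))⁻¹) S :=
      ((hasDerivAt_id S).sub ((Real.hasDerivAt_arsinh S).const_mul g)).sub_const L
    rw [h.deriv]
    simp [ptPair]
  | succ n ih =>
    rw [iteratedDeriv_succ, ih]
    funext S
    have h := (((quot_deriv n S).const_mul ((-1) ^ n * (Nat.factorial n : ℝ))).const_mul g).const_sub
      (if n = 0 then (1 : ℝ) else 0)
    rw [h.deriv, Nat.factorial_succ, if_neg (Nat.succ_ne_zero n)]
    push_cast
    ring

lemma alpha0_pos : 0 < alpha0 := by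
  unfold alpha0
  nlinarith [Real.sq_sqrt (show (0 : ℝ) ≤ 2 by norm_num), Real.sqrt_nonneg 2]

lemma core (S r q g L : ℝ) (hS : 0 < S) (hg0 : 0 < g) (hg1 : g < 1)
    (hr : r = Real.sqrt (1 + S ^ 2)) (hr1 : 1 < r)
    (hq : 1 ≤ q) (hq2 : 1 ≤ 3 * (r - 1) * q ^ 2) (hq1 : S ≤ 2 * r * (r - 1) * q)
    (hD : |S - g * Real.arsinh S - L| < alpha0 * (r - 1) / q) :
    ApproxZero (fhk g L) S := by
  have hr0 : 0 < r := by linarith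
  have hrm : 0 < r - 1 := by linarith
  have hd : deriv (fhk g L) S = (r - g) / r := by
    have := congrFun (fhk_iter_s16 g L 0) S
    rw [zero_add, iteratedDeriv_one] at this
    rw [this, ← hr]
    simp [ptPair]
    field_simp
  have hrg : 0 < r - g := by linarith
  set d := (r - g) / r with hdd
  have hd0 : 0 < d := by positivity
  have hm : (r - 1) / r ≤ d := by rw [hdd]; gcongr
  set B := q / (r - 1) * d with hB
  have hBm : q / r ≤ B := by
    rw [hB]
    calc q / r = q / (r - 1) * ((r - 1) / r) := by field_simp
      _ ≤ _ := by gcongr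
  have hB0 : 0 < B := by positivity
  have hgam : gammaFn (fhk g L) S ≤ B := by
    unfold gammaFn
    apply csSup_le
    · exact ⟨_, 2, le_refl _, rfl⟩
    rintro y ⟨k, hk, rfl⟩
    obtain ⟨n, rfl⟩ : ∃ n, k = n + 1 := ⟨k - 1, by omega⟩
    have hn1 : 1 ≤ n := by omega
    have hn0 : n ≠ 0 := by omega
    have hnr : (0 : ℝ) < n := by exact_mod_cast hn1
    rw [hd, fhk_iter_s16]
    simp only [hn0, if_false, ← hr]
    have habs : |(0 - g * ((-1) ^ n * (Nat.factorial n : ℝ) *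
        ((ptPair n S).1 / r ^ (2 * n + 1)))) / ((Nat.factorial (n + 1) : ℝ) * d)|
        = g * |(ptPair n S).1| / (((n : ℝ) + 1) * r ^ (2 * n + 1) * d) := by
      rw [zero_sub, abs_div, abs_neg, abs_mul, abs_mul, abs_mul, abs_div, abs_pow, abs_neg, abs_one,
        one_pow, abs_mul, abs_of_pos hd0, abs_of_pos hg0, Nat.abs_cast, Nat.abs_cast, abs_of_pos
        (pow_pos hr0 _), Nat.factorial_succ]
      have : (Nat.factorial n : ℝ) ≠ 0 := by positivity
      push_cast
      field_simp
    rw [habs]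
    have hle : g * |(ptPair n S).1| / (((n : ℝ) + 1) * r ^ (2 * n + 1) * d) ≤ B ^ n := by
      calc _ ≤ 1 * |(ptPair n S).1| / (((n : ℝ) + 1) * r ^ (2 * n + 1) * ((r - 1) / r)) := by
            gcongr
        _ = |(ptPair n S).1| / (((n : ℝ) + 1) * r ^ (2 * n) * (r - 1)) := by
            rw [pow_succ]; field_simp
        _ ≤ (q / r) ^ n := by
            rcases Nat.lt_or_ge n 2 with h | h
            · obtain rfl : n = 1 := by omega
              simp only [ptPair]
              norm_num
              rw [abs_of_pos hS, div_le_div_iff₀ (by positivity) hr0]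
              nlinarith
            · have hb : |(ptPair n S).1| ≤ r ^ n := by
                refine abs_le_of_sq_le_sq ?_ (by positivity)
                have := (ptPair_bound n S).1
                rw [← pow_mul, mul_comm n 2, pow_mul, hr, Real.sq_sqrt (by positivity)]
                exact this
              rw [div_pow, div_le_div_iff₀ (by positivity) (by positivity)]
              have hqn : q ^ 2 ≤ q ^ n := pow_le_pow_right₀ hq h
              have hn2 : (2 : ℝ) ≤ n := by exact_mod_cast h
              have h1 : 1 ≤ q ^ n * ((n : ℝ) + 1) * (r - 1) := by
                calc (1 : ℝ) ≤ q ^ 2 * (2 + 1) * (r - 1) := by linarith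
                  _ ≤ _ := by gcongr
              calc |(ptPair n S).1| * r ^ n ≤ r ^ n * r ^ n * 1 := by
                    rw [mul_one]; gcongr
                _ ≤ r ^ n * r ^ n * (q ^ n * ((n : ℝ) + 1) * (r - 1)) := by gcongr
                _ = _ := by ring
        _ ≤ B ^ n := by gcongr
    have hex : (1 : ℝ) / (((n + 1 : ℕ) : ℝ) - 1) = (n : ℝ)⁻¹ := by push_cast; simp
    rw [hex]
    calc _ ≤ (B ^ n) ^ ((n : ℝ)⁻¹) := by
          apply Real.rpow_le_rpow (by positivity) hle (by positivity)
      _ = B := Real.pow_rpow_inv_natCast hB0.le hn0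
  unfold ApproxZero alphaFn betaFn
  rw [hd, abs_div, abs_of_pos hd0]
  calc _ ≤ |fhk g L S| / d * B := by gcongr
    _ = |S - g * Real.arsinh S - L| * (q / (r - 1)) := by
      rw [hB]; unfold fhk; field_simp
    _ < alpha0 * (r - 1) / q * (q / (r - 1)) := by
      gcongr
    _ = alpha0 := by field_simp

/-- Theorem 3.1 (positive case): for `S₀ > 0`, the constant starter `S̃ = S₀` is an
approximate zero of `f_{g,L}` in the stripe
`R₃(S₀) = {0 < g < 1, S₀ - g·arcsinh(S₀) - Δ(S₀) < L < S₀ - g·arcsinh(S₀) + Δ(S₀)}`. -/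
theorem constant_starter_stripe (S₀ : ℝ) (hS₀ : 0 < S₀) (g L : ℝ)
    (hg0 : 0 < g) (hg1 : g < 1)
    (hL1 : S₀ - g * Real.arsinh S₀ - Delta S₀ < L)
    (hL2 : L < S₀ - g * Real.arsinh S₀ + Delta S₀) :
    ApproxZero (fhk g L) S₀ := by
  have hD : |S₀ - g * Real.arsinh S₀ - L| < Delta S₀ := by
    rw [abs_lt]; constructor <;> linarith
  obtain ⟨r, hr⟩ : ∃ r, r = Real.sqrt (1 + S₀ ^ 2) := ⟨_, rfl⟩
  have hrsq : r ^ 2 = 1 + S₀ ^ 2 := by rw [hr, Real.sq_sqrt (by positivity)]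
  have hrn : 0 ≤ r := hr ▸ Real.sqrt_nonneg _
  have hr1 : 1 < r := by nlinarith [pow_pos hS₀ 2]
  have hr0 : 0 < r := by linarith
  have hrm : 0 < r - 1 := by linarith
  have h7 : Real.sqrt 7 ^ 2 = 7 := Real.sq_sqrt (by norm_num)
  have h7n : 0 ≤ Real.sqrt 7 := Real.sqrt_nonneg _
  unfold Delta at hD
  rw [← hr] at hD
  split_ifs at hD with hc
  · have hr43 : r ≤ 4 / 3 := by
      have : S₀ ^ 2 ≤ (Real.sqrt 7 / 3) ^ 2 := by gcongr
      nlinarith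
    obtain ⟨u, hu⟩ : ∃ u, u = Real.sqrt (r - 1) := ⟨_, rfl⟩
    obtain ⟨v, hv⟩ : ∃ v, v = Real.sqrt (r + 1) := ⟨_, rfl⟩
    obtain ⟨w, hw⟩ : ∃ w, w = Real.sqrt 3 := ⟨_, rfl⟩
    have hu0 : 0 < u := hu ▸ Real.sqrt_pos.2 hrm
    have hv0 : 0 < v := hv ▸ Real.sqrt_pos.2 (by linarith)
    have hw0 : 0 < w := hw ▸ Real.sqrt_pos.2 (by norm_num)
    have hu2 : u ^ 2 = r - 1 := by rw [hu, Real.sq_sqrt hrm.le]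
    have hv2 : v ^ 2 = r + 1 := by rw [hv, Real.sq_sqrt (by linarith)]
    have hw2 : w ^ 2 = 3 := by rw [hw, Real.sq_sqrt (by norm_num)]
    have hS : S₀ = u * v := by
      have : S₀ ^ 2 = (u * v) ^ 2 := by rw [mul_pow, hu2, hv2]; linarith
      exact (pow_left_inj₀ hS₀.le (by positivity) (by norm_num)).1 this
    have hrp : (r + 1) ^ ((3 : ℝ) / 2) = v ^ 3 := by
      rw [← hv2, ← Real.rpow_natCast v 2, ← Real.rpow_mul hv0.le, ← Real.rpow_natCast v 3]
      norm_num
    have hwu : w * u ≤ 1 := by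
      have : (w * u) ^ 2 ≤ 1 := by rw [mul_pow, hu2, hw2]; linarith
      nlinarith [mul_pos hw0 hu0]
    have hwur : w * r * u ≤ 4 / 3 := by nlinarith
    refine core S₀ r (2 / (w * r * u)) g L hS₀ hg0 hg1 hr hr1 ?_ ?_ ?_ ?_
    · rw [le_div_iff₀ (by positivity)]; linarith
    · have : 3 * (r - 1) * (2 / (w * r * u)) ^ 2 = 4 / r ^ 2 := by
        rw [div_pow, mul_pow, mul_pow, hw2, hu2]; field_simp; norm_num
      rw [this, le_div_iff₀ (by positivity)]; nlinarith
    · have : 2 * r * (r - 1) * (2 / (w * r * u)) = u * (4 / w) := by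
        rw [← hu2]; field_simp; norm_num
      rw [this, hS]
      have : v ≤ 4 / w := by
        rw [le_div_iff₀ hw0]
        have : (v * w) ^ 2 ≤ 4 ^ 2 := by rw [mul_pow, hv2, hw2]; linarith
        exact (pow_le_pow_iff_left₀ (by positivity) (by norm_num) (by norm_num)).1 this
      gcongr
    · refine hD.trans_eq ?_
      rw [hrp, ← hw, ← hu2]
      nth_rewrite 1 [hS]
      field_simp
  · push Not at hc
    have hr43 : 4 / 3 ≤ r := by
      have : (Real.sqrt 7 / 3) ^ 2 ≤ S₀ ^ 2 := by gcongr
      nlinarith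
    have hS1 : S₀ ≤ r := by nlinarith
    rcases le_total S₀ 1 with h | h
    · rw [min_eq_right h] at hD
      have hr2 : r ≤ 3 / 2 := by nlinarith
      refine core S₀ r (2 / r) g L hS₀ hg0 hg1 hr hr1 ?_ ?_ ?_ ?_
      · rw [le_div_iff₀ hr0]; linarith
      · rw [div_pow, mul_div_assoc', le_div_iff₀ (by positivity)]; nlinarith
      · have : 2 * r * (r - 1) * (2 / r) = 4 * (r - 1) := by field_simp; norm_num
        rw [this]; linarith
      · refine hD.trans_eq ?_
        have : S₀ ^ 2 = (r - 1) * (r + 1) := by linarith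
        have e : alpha0 * S₀ * S₀ * r = alpha0 * S₀ ^ 2 * r := by ring
        rw [e, this]
        field_simp
    · rw [min_eq_left h] at hD
      have hr2 : r ≤ 2 * S₀ := by nlinarith
      have hr3 : r ^ 2 ≤ 2 * S₀ ^ 2 := by nlinarith
      refine core S₀ r (2 * S₀ / r) g L hS₀ hg0 hg1 hr hr1 ?_ ?_ ?_ ?_
      · rw [le_div_iff₀ hr0]; linarith
      · rw [div_pow, mul_div_assoc', le_div_iff₀ (by positivity)]; nlinarith
      · have : 2 * r * (r - 1) * (2 * S₀ / r) = 4 * (r - 1) * S₀ := by field_simp; norm_num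
        rw [this]; nlinarith
      · refine hD.trans_eq ?_
        have : S₀ ^ 2 = (r - 1) * (r + 1) := by linarith
        rw [div_eq_div_iff (by positivity) (by positivity), div_eq_mul_inv]
        field_simp
        linear_combination alpha0 * this
end
end
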